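/- Let γ > 2 and 6 < r ≤ r̃ < ∞ with r̃ ≠ 6/(3−γ). Then there exists a constant C > 0 such that for all t ≠ 0: ‖K_γ(·,t)‖_{W(r̃/2, r/2)_x} ≤ C |t|^{−1+6/r} if |t| ≥ 1, and ‖K_γ(·,t)‖_{W(r̃/2, r/2)_x} ≤ C max{1, |t|^{−3+γ+6/r̃}} if 0 < |t| ≤ 1. -/

import Mathlib

open MeasureTheory Real Complex

noncomputable section

/-- `⟨ξ⟩ = √(1+|ξ|²)`. -/
def jap (ξ : EuclideanSpace ℝ (Fin 3)) : ℝ := Real.sqrt (1 + ‖ξ‖ ^ 2)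

/-- The dot product `x·ξ` on `ℝ³`. -/
def dotE (x ξ : EuclideanSpace ℝ (Fin 3)) : ℝ := ∑ i, x i * ξ i

/-- The Littlewood–Paley cutoff `χ_k(ξ) = ρ(2^{-(k+1)}|ξ|) - ρ(2^{-(k-2)}|ξ|)`. -/
def chiLP (ρ : ℝ → ℝ) (k : ℤ) (ξ : EuclideanSpace ℝ (Fin 3)) : ℝ :=
  ρ ((2 : ℝ) ^ (-(k + 1)) * ‖ξ‖) - ρ ((2 : ℝ) ^ (-(k - 2)) * ‖ξ‖)

/-- The localized kernel `K_γ^k(x,t) = ∫ e^{ix·ξ} e^{it⟨ξ⟩} ⟨ξ⟩^{-γ} χ_k(ξ) dξ`. -/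
def Kloc (ρ : ℝ → ℝ) (γ : ℝ) (k : ℤ) (x : EuclideanSpace ℝ (Fin 3)) (t : ℝ) : ℂ :=
  ∫ ξ : EuclideanSpace ℝ (Fin 3),
    Complex.exp (I * ((dotE x ξ : ℝ) + (t : ℝ) * jap ξ)) * ((jap ξ ^ (-γ) * chiLP ρ k ξ : ℝ) : ℂ)

/-- The kernel `K_γ(x,t) = Σ_{k ∈ ℤ} K_γ^k(x,t)`. -/
def Kker (ρ : ℝ → ℝ) (γ : ℝ) (x : EuclideanSpace ℝ (Fin 3)) (t : ℝ) : ℂ :=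
  ∑' k : ℤ, Kloc ρ γ k x t

/-- The Euclidean norm `|(x,t)|` of `(x,t) ∈ ℝ³ × ℝ = ℝ⁴`. -/
def xtNorm (x : EuclideanSpace ℝ (Fin 3)) (t : ℝ) : ℝ := Real.sqrt (‖x‖ ^ 2 + t ^ 2)
open scoped ENNReal NNReal

/-- The `L^p` norm (with `p ∈ [1,∞]`) of an `ℝ≥0∞`-valued function. -/
def LpE {α : Type*} [MeasurableSpace α] (μ : MeasureTheory.Measure α) (p : ℝ≥0∞)
    (f : α → ℝ≥0∞) : ℝ≥0∞ :=
  if p = ∞ then essSup f μ else (∫⁻ a, f a ^ p.toReal ∂μ) ^ (1 / p.toReal)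

/-- The Wiener amalgam norm `‖g‖_{W(p',p)}` on `ℝ³` with window `ψ`,
applied to the pointwise magnitude `g : ℝ³ → ℝ≥0∞` of a function. -/
def WAx (ψ : EuclideanSpace ℝ (Fin 3) → ℝ) (p' p : ℝ≥0∞)
    (g : EuclideanSpace ℝ (Fin 3) → ℝ≥0∞) : ℝ≥0∞ :=
  LpE MeasureTheory.volume p
    (fun y => LpE MeasureTheory.volume p' (fun x => g x * ‖ψ (x - y)‖₊))

/-- Rotation: reduce to the first coordinate axis. -/
lemma rad_rotate (h : ℝ → ℂ) (x : EuclideanSpace ℝ (Fin 3)) (hx : x ≠ 0) :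
    ∫ ξ : EuclideanSpace ℝ (Fin 3), Complex.exp (I * ((dotE x ξ : ℝ) : ℂ)) * h ‖ξ‖
      = ∫ ζ : EuclideanSpace ℝ (Fin 3), Complex.exp (I * ((‖x‖ * ζ 0 : ℝ) : ℂ)) * h ‖ζ‖ := by
  have hx' : ‖x‖ ≠ 0 := norm_ne_zero_iff.mpr hx
  let v : Fin 3 → EuclideanSpace ℝ (Fin 3) := fun _ => (‖x‖)⁻¹ • x
  have hv : Orthonormal ℝ (({0} : Set (Fin 3)).domRestrict v) := by
    constructor
    · intro i
      change ‖(‖x‖)⁻¹ • x‖ = 1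
      simp [norm_smul, hx']
    · intro i j hij
      exact absurd (Subsingleton.elim i j) hij
  obtain ⟨b, hb⟩ := hv.exists_orthonormalBasis_extension_of_card_eq (by simp)
  have hb0 : b 0 = (‖x‖)⁻¹ • x := hb 0 rfl
  have hmp := b.repr.measurePreserving
  refine Eq.trans ?_ (hmp.integral_comp b.repr.toHomeomorph.measurableEmbedding
    (fun ζ : EuclideanSpace ℝ (Fin 3) => Complex.exp (I * ((‖x‖ * ζ 0 : ℝ) : ℂ)) * h ‖ζ‖))
  refine integral_congr_ae (Filter.Eventually.of_forall fun ξ => ?_)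
  have h1 : ‖x‖ * (b.repr ξ) 0 = dotE x ξ := by
    rw [b.repr_apply_apply, hb0, real_inner_smul_left, ← mul_assoc, mul_inv_cancel₀ hx', one_mul,
      PiLp.inner_apply]
    simp [dotE, mul_comm]
  simp only [h1, LinearIsometryEquiv.norm_map]

/-- Splitting off the first coordinate. -/
lemma rad_split (F : ℝ → ℝ → ℂ) :
    ∫ ζ : EuclideanSpace ℝ (Fin 3), F (ζ 0) ‖ζ‖
      = ∫ p : ℝ × EuclideanSpace ℝ (Fin 2), F p.1 (Real.sqrt (p.1 ^ 2 + ‖p.2‖ ^ 2)) := by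
  have m1 := (EuclideanSpace.volume_preserving_symm_measurableEquiv_toLp (Fin 3)).symm
  have m2 := (volume_preserving_piFinSuccAbove (fun _ : Fin 3 => ℝ) 0).symm
  have m3 := (MeasurePreserving.id (volume : Measure ℝ)).prod
    (EuclideanSpace.volume_preserving_symm_measurableEquiv_toLp (Fin 2))
  rw [← m1.integral_comp (MeasurableEquiv.measurableEmbedding _),
    ← m2.integral_comp (MeasurableEquiv.measurableEmbedding _)]
  have e3 : MeasurableEmbedding (Prod.map (id : ℝ → ℝ)
      ((MeasurableEquiv.toLp 2 (Fin 2 → ℝ)).symm)) :=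
    MeasurableEmbedding.id.prodMap (MeasurableEquiv.measurableEmbedding _)
  have := m3.integral_comp e3 (g := fun y : ℝ × (Fin 2 → ℝ) =>
    F (((MeasurableEquiv.toLp 2 (Fin 3 → ℝ)).symm.symm ((MeasurableEquiv.piFinSuccAbove (fun _ : Fin 3 => ℝ) 0).symm y)) 0)
     ‖((MeasurableEquiv.toLp 2 (Fin 3 → ℝ)).symm.symm ((MeasurableEquiv.piFinSuccAbove (fun _ : Fin 3 => ℝ) 0).symm y))‖)
  refine Eq.trans this.symm ?_
  refine integral_congr_ae (Filter.Eventually.of_forall fun p => ?_)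
  have hn : ∀ ζ : EuclideanSpace ℝ (Fin 3), ‖ζ‖ = Real.sqrt (ζ 0 ^ 2 + ζ 1 ^ 2 + ζ 2 ^ 2) := by
    intro ζ
    rw [EuclideanSpace.norm_eq]
    simp [Fin.sum_univ_succ, add_assoc]
  have hn2 : ‖p.2‖ ^ 2 = p.2 0 ^ 2 + p.2 1 ^ 2 := by
    rw [EuclideanSpace.norm_sq_eq]
    simp [Fin.sum_univ_succ]
  simp only [hn, hn2, ← add_assoc]
  rfl

lemma radPsi_hasDerivAt (h : ℝ → ℂ) (hc : Continuous h) (z : ℝ) :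
    HasDerivAt (fun z : ℝ => ∫ u in (0 : ℝ)..z, (u : ℂ) * h |u|) ((z : ℂ) * h |z|) z := by
  have hc' : Continuous (fun u : ℝ => (u : ℂ) * h |u|) := by fun_prop
  exact (hc'.integral_hasStrictDerivAt 0 z).hasDerivAt

lemma radPsi_even (h : ℝ → ℂ) (z : ℝ) :
    ∫ u in (0 : ℝ)..|z|, (u : ℂ) * h |u| = ∫ u in (0 : ℝ)..z, (u : ℂ) * h |u| := by
  rcases abs_cases z with ⟨h1, _⟩ | ⟨h1, _⟩
  · rw [h1]
  · rw [h1]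
    have := intervalIntegral.integral_comp_neg (a := 0) (b := z) (fun u : ℝ => (u : ℂ) * h |u|)
    simp only [abs_neg, neg_zero, Complex.ofReal_neg, neg_mul, intervalIntegral.integral_neg] at this
    rw [intervalIntegral.integral_symm, ← this, neg_neg]

lemma radPsi_const (h : ℝ → ℂ) (hc : Continuous h) (A : ℝ) (hA : 0 < A)
    (hA0 : ∀ s, A ≤ s → h s = 0) (z : ℝ) (hz : A ≤ z) :
    ∫ u in (0 : ℝ)..z, (u : ℂ) * h |u| = ∫ u in (0 : ℝ)..A, (u : ℂ) * h |u| := by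
  have hc' : Continuous (fun u : ℝ => (u : ℂ) * h |u|) := by fun_prop
  rw [← intervalIntegral.integral_add_adjacent_intervals (hc'.intervalIntegrable 0 A)
    (hc'.intervalIntegrable A z)]
  have : ∫ u in A..z, (u : ℂ) * h |u| = 0 := by
    rw [intervalIntegral.integral_congr (g := fun _ => (0 : ℂ))]
    · simp
    · intro u hu
      rw [Set.uIcc_of_le hz] at hu
      have : h |u| = 0 := hA0 _ (hu.1.trans (le_abs_self u))
      simp [this]
  rw [this, add_zero]

lemma rad_inner (h : ℝ → ℂ) (hc : Continuous h) (A : ℝ) (hA : 0 < A)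
    (hA0 : ∀ s, A ≤ s → h s = 0) (z : ℝ) :
    ∫ y in Set.Ioi (0 : ℝ), (y : ℂ) * h (Real.sqrt (z ^ 2 + y ^ 2))
      = (∫ u in (0 : ℝ)..A, (u : ℂ) * h |u|) - ∫ u in (0 : ℝ)..z, (u : ℂ) * h |u| := by
  have hle : ∀ y : ℝ, |y| ≤ Real.sqrt (z ^ 2 + y ^ 2) := fun y =>
    Real.abs_le_sqrt (by nlinarith [sq_nonneg z])
  have hcont : Continuous (fun y : ℝ => ∫ u in (0 : ℝ)..Real.sqrt (z ^ 2 + y ^ 2), (u : ℂ) * h |u|) := by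
    have h1 : Continuous (fun z : ℝ => ∫ u in (0 : ℝ)..z, (u : ℂ) * h |u|) :=
      continuous_iff_continuousAt.2 fun z => (radPsi_hasDerivAt h hc z).continuousAt
    exact h1.comp (by fun_prop)
  have key := integral_Ioi_of_hasDerivAt_of_tendsto (a := (0 : ℝ))
    (f := fun y : ℝ => ∫ u in (0 : ℝ)..Real.sqrt (z ^ 2 + y ^ 2), (u : ℂ) * h |u|)
    (f' := fun y : ℝ => (y : ℂ) * h (Real.sqrt (z ^ 2 + y ^ 2)))
    (m := ∫ u in (0 : ℝ)..A, (u : ℂ) * h |u|) hcont.continuousWithinAt ?_ ?_ ?_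
  · rw [key]
    congr 1
    rw [← radPsi_even h z]
    simp [Real.sqrt_sq_eq_abs]
  · intro y hy
    have hy' : (0 : ℝ) < y := hy
    have hpos : 0 < z ^ 2 + y ^ 2 := by positivity
    have hs : 0 < Real.sqrt (z ^ 2 + y ^ 2) := Real.sqrt_pos.2 hpos
    have d1 : HasDerivAt (fun y : ℝ => Real.sqrt (z ^ 2 + y ^ 2))
        (y / Real.sqrt (z ^ 2 + y ^ 2)) y := by
      have := ((hasDerivAt_pow 2 y).const_add (z ^ 2)).sqrt hpos.ne'
      convert this using 1
      field_simp
      simp [mul_comm]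
    have d2 := (radPsi_hasDerivAt h hc (Real.sqrt (z ^ 2 + y ^ 2))).scomp y d1
    refine d2.congr_deriv ?_
    rw [abs_of_pos hs, Complex.real_smul, ← mul_assoc, ← Complex.ofReal_mul,
      div_mul_cancel₀ _ hs.ne']
  · apply Integrable.integrableOn
    apply Continuous.integrable_of_hasCompactSupport (by fun_prop)
    apply HasCompactSupport.intro (isCompact_Icc (a := -A) (b := A))
    intro y hy
    have : A ≤ |y| := by
      by_contra hcon
      exact hy (abs_le.1 (not_le.1 hcon).le)
    rw [hA0 _ (this.trans (hle y)), mul_zero]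
  · apply tendsto_const_nhds.congr'
    filter_upwards [Filter.eventually_ge_atTop A] with y hy
    exact (radPsi_const h hc A hA hA0 _ (hy.trans ((le_abs_self y).trans (hle y)))).symm

lemma rad_byparts (h : ℝ → ℂ) (hc : Continuous h) (A : ℝ) (hA : 0 < A)
    (hA0 : ∀ s, A ≤ s → h s = 0) (r : ℝ) (hr : 0 < r) :
    ∫ z : ℝ, Complex.exp (I * ((r * z : ℝ) : ℂ)) *
      ((∫ u in (0 : ℝ)..A, (u : ℂ) * h |u|) - ∫ u in (0 : ℝ)..z, (u : ℂ) * h |u|)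
      = 2 * ∫ s in Set.Ioi (0 : ℝ), ((Real.sin (r * s) / r * s : ℝ) : ℂ) * h s := by
  set P : ℝ → ℂ := fun z => (∫ u in (0 : ℝ)..A, (u : ℂ) * h |u|) - ∫ u in (0 : ℝ)..z, (u : ℂ) * h |u|
    with hP
  have hPd : ∀ z : ℝ, HasDerivAt P (-((z : ℂ) * h |z|)) z := fun z =>
    (radPsi_hasDerivAt h hc z).const_sub _
  have hPc : Continuous P := continuous_iff_continuousAt.2 fun z => (hPd z).continuousAt
  have habs : ∀ y : ℝ, y ∉ Set.Icc (-A) A → A ≤ |y| := by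
    intro y hy
    by_contra hcon
    exact hy (abs_le.1 (not_le.1 hcon).le)
  have hP0 : ∀ z, z ∉ Set.Icc (-A) A → P z = 0 := by
    intro z hz
    rw [hP]
    simp only
    rw [← radPsi_even h z, radPsi_const h hc A hA hA0 _ (habs z hz), sub_self]
  have hh0 : ∀ z, z ∉ Set.Icc (-A) A → h |z| = 0 := fun z hz => hA0 _ (habs z hz)
  have hrc : (r : ℂ) ≠ 0 := by exact_mod_cast hr.ne'
  have hud : ∀ z : ℝ, HasDerivAt (fun z : ℝ => Complex.exp (I * ((r * z : ℝ) : ℂ)) / (I * r))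
      (Complex.exp (I * ((r * z : ℝ) : ℂ))) z := by
    intro z
    have h1 : HasDerivAt (fun z : ℝ => I * ((r * z : ℝ) : ℂ)) (I * (r : ℂ)) z := by
      have := ((hasDerivAt_id z).const_mul r).ofReal_comp.const_mul I
      simpa using this
    have := h1.cexp.div_const (I * r)
    refine this.congr_deriv ?_
    rw [mul_div_assoc, div_self (mul_ne_zero Complex.I_ne_zero hrc), mul_one]
  have int1 : Integrable (fun z : ℝ => Complex.exp (I * ((r * z : ℝ) : ℂ)) * P z) := by
    apply Continuous.integrable_of_hasCompactSupport (by fun_prop)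
    apply HasCompactSupport.intro (isCompact_Icc (a := -A) (b := A))
    intro y hy
    simp [hP0 y hy]
  have int2 : Integrable (fun z : ℝ => Complex.exp (I * ((r * z : ℝ) : ℂ)) / (I * r) * P z) := by
    apply Continuous.integrable_of_hasCompactSupport (by fun_prop)
    apply HasCompactSupport.intro (isCompact_Icc (a := -A) (b := A))
    intro y hy
    simp [hP0 y hy]
  have int3 : Integrable (fun z : ℝ => Complex.exp (I * ((r * z : ℝ) : ℂ)) / (I * r) *
      (-((z : ℂ) * h |z|))) := by
    apply Continuous.integrable_of_hasCompactSupport (by fun_prop)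
    apply HasCompactSupport.intro (isCompact_Icc (a := -A) (b := A))
    intro y hy
    simp [hh0 y hy]
  have ibp := integral_mul_deriv_eq_deriv_mul_of_integrable (fun z _ => hud z) (fun z _ => hPd z)
    int3 int1 int2
  have ibp' : ∫ z : ℝ, Complex.exp (I * ((r * z : ℝ) : ℂ)) * P z =
      ∫ z : ℝ, Complex.exp (I * ((r * z : ℝ) : ℂ)) / (I * r) * ((z : ℂ) * h |z|) := by
    simp only [mul_neg, integral_neg] at ibp
    exact (neg_injective ibp).symm
  rw [ibp']
  set f : ℝ → ℂ := fun z => Complex.exp (I * ((r * z : ℝ) : ℂ)) / (I * r) * ((z : ℂ) * h |z|) with hf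
  have intf : Integrable f := by
    have := int3.neg
    refine this.congr (Filter.Eventually.of_forall fun z => ?_)
    simp [hf]
  have e1 : ∫ z, f (-z) = ∫ z, f z := integral_neg_eq_self f volume
  have e2 : (∫ z, f z) + ∫ z, f z = ∫ z, (f z + f (-z)) := by
    rw [integral_add intf intf.comp_neg, e1]
  have e3 : ∀ z, f z + f (-z) = (fun s : ℝ => 2 * (((Real.sin (r * s) / r * s : ℝ) : ℂ) * h s)) ‖z‖ := by
    intro z
    have hs : Real.sin (r * |z|) * |z| = Real.sin (r * z) * z := by
      rcases abs_cases z with ⟨h1, _⟩ | ⟨h1, _⟩ <;> rw [h1]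
      rw [mul_neg r z, Real.sin_neg]; ring
    have hs' : Real.sin (r * |z|) / r * |z| = Real.sin (r * z) * z / r := by
      rw [← hs]; ring
    simp only [hf, Real.norm_eq_abs, abs_neg, hs']
    push_cast
    rw [Complex.sin]
    have : -((r:ℂ) * z) * I = I * (r * -z) := by ring
    rw [this, show (r:ℂ) * z * I = I * (r * z) by ring]
    field_simp
    ring_nf
    simp [Complex.I_sq]
    ring
  have e4 : ∫ z, (f z + f (-z)) = 2 * (2 * ∫ s in Set.Ioi (0 : ℝ),
      ((Real.sin (r * s) / r * s : ℝ) : ℂ) * h s) := by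
    rw [integral_congr_ae (Filter.Eventually.of_forall e3), integral_fun_norm_addHaar volume
      (fun s : ℝ => 2 * (((Real.sin (r * s) / r * s : ℝ) : ℂ) * h s))]
    simp [Measure.real, ← integral_const_mul]
  rw [← e2] at e4
  linear_combination e4 / 2

lemma rad_formula (h : ℝ → ℂ) (hc : Continuous h) (A : ℝ) (hA : 0 < A)
    (hA0 : ∀ s, A ≤ s → h s = 0) (x : EuclideanSpace ℝ (Fin 3)) (hx : x ≠ 0) :
    ∫ ξ : EuclideanSpace ℝ (Fin 3), Complex.exp (I * ((dotE x ξ : ℝ) : ℂ)) * h ‖ξ‖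
      = (4 * (volume : Measure (EuclideanSpace ℝ (Fin 2))).real (Metric.ball 0 1) : ℝ) *
        ∫ s in Set.Ioi (0 : ℝ), ((Real.sin (‖x‖ * s) / ‖x‖ * s : ℝ) : ℂ) * h s := by
  have hr : 0 < ‖x‖ := norm_pos_iff.2 hx
  rw [rad_rotate h x hx, rad_split (fun z s => Complex.exp (I * ((‖x‖ * z : ℝ) : ℂ)) * h s)]
  have int : Integrable (fun p : ℝ × EuclideanSpace ℝ (Fin 2) =>
      Complex.exp (I * ((‖x‖ * p.1 : ℝ) : ℂ)) * h (Real.sqrt (p.1 ^ 2 + ‖p.2‖ ^ 2)))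
      (volume.prod volume) := by
    apply Continuous.integrable_of_hasCompactSupport (by fun_prop)
    apply HasCompactSupport.intro (isCompact_closedBall (0 : ℝ × EuclideanSpace ℝ (Fin 2)) A)
    intro p hp
    have : A ≤ Real.sqrt (p.1 ^ 2 + ‖p.2‖ ^ 2) := by
      have h1 : A < ‖p‖ := by simpa using hp
      rw [Prod.norm_def] at h1
      refine h1.le.trans (max_le ?_ ?_)
      · exact Real.abs_le_sqrt (by nlinarith [sq_nonneg ‖p.2‖])
      · exact (le_abs_self _).trans (Real.abs_le_sqrt (by nlinarith [sq_nonneg p.1]))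
    rw [hA0 _ this, mul_zero]
  change ∫ p : ℝ × EuclideanSpace ℝ (Fin 2), _ ∂(volume.prod volume) = _
  rw [integral_prod _ int]
  have inner : ∀ z : ℝ, ∫ η : EuclideanSpace ℝ (Fin 2),
      Complex.exp (I * ((‖x‖ * z : ℝ) : ℂ)) * h (Real.sqrt (z ^ 2 + ‖η‖ ^ 2)) =
      (2 * (volume : Measure (EuclideanSpace ℝ (Fin 2))).real (Metric.ball 0 1) : ℝ) *
      (Complex.exp (I * ((‖x‖ * z : ℝ) : ℂ)) *
      ((∫ u in (0 : ℝ)..A, (u : ℂ) * h |u|) - ∫ u in (0 : ℝ)..z, (u : ℂ) * h |u|)) := by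
    intro z
    rw [integral_const_mul, integral_fun_norm_addHaar volume
      (fun s => h (Real.sqrt (z ^ 2 + s ^ 2))), ← rad_inner h hc A hA hA0 z]
    simp only [finrank_euclideanSpace, Fintype.card_fin, Nat.add_one_sub_one, pow_one,
      Complex.real_smul, nsmul_eq_mul]
    push_cast
    ring
  simp only [inner]
  rw [integral_const_mul, rad_byparts h hc A hA hA0 _ hr]
  push_cast
  ring

/-- one dimensional Japanese bracket -/
def jw (s : ℝ) : ℝ := Real.sqrt (1 + s ^ 2)

/-- rescaled one dimensional cutoff -/
def cq (ρ : ℝ → ℝ) (q s : ℝ) : ℝ := ρ (1 / (2 * q) * s) - ρ (4 / q * s)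

/-- derivative of the rescaled cutoff -/
def cq' (ρ : ℝ → ℝ) (q s : ℝ) : ℝ :=
  1 / (2 * q) * deriv ρ (1 / (2 * q) * s) - 4 / q * deriv ρ (4 / q * s)

/-- radial profile -/
def hprof (ρ : ℝ → ℝ) (γ q t s : ℝ) : ℂ :=
  Complex.exp (I * ((t * jw s : ℝ) : ℂ)) * ((jw s ^ (-γ) * cq ρ q s : ℝ) : ℂ)

lemma jw_pos (s : ℝ) : 0 < jw s := Real.sqrt_pos.2 (by positivity)

lemma jw_one_le (s : ℝ) : 1 ≤ jw s := by
  rw [jw, Real.le_sqrt' one_pos]; nlinarith [sq_nonneg s]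

lemma jw_abs_le (s : ℝ) : |s| ≤ jw s := Real.abs_le_sqrt (by linarith)

lemma jw_continuous : Continuous jw := by unfold jw; fun_prop

lemma jw_hasDerivAt (s : ℝ) : HasDerivAt jw (s / jw s) s := by
  have hpos : 0 < 1 + s ^ 2 := by positivity
  have := ((hasDerivAt_pow 2 s).const_add 1).sqrt hpos.ne'
  refine this.congr_deriv ?_
  have := jw_pos s
  simp only [jw] at this ⊢
  field_simp
  simp [mul_comm]

lemma jw_rpow_continuous (a : ℝ) : Continuous (fun s => jw s ^ a) :=
  jw_continuous.rpow_const (fun s => Or.inl (jw_pos s).ne')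

lemma cq_hasDerivAt (ρ : ℝ → ℝ) (hρ : ContDiff ℝ (⊤ : ℕ∞) ρ) (q s : ℝ) :
    HasDerivAt (cq ρ q) (cq' ρ q s) s := by
  have hd : Differentiable ℝ ρ := hρ.differentiable (by simp)
  have h1 : ∀ a : ℝ, HasDerivAt (fun s => ρ (a * s)) (a * deriv ρ (a * s)) s := by
    intro a
    have := (hd (a * s)).hasDerivAt.comp s ((hasDerivAt_id s).const_mul a)
    refine this.congr_deriv ?_
    simp [mul_comm]
  exact (h1 _).sub (h1 _)

lemma cq_continuous (ρ : ℝ → ℝ) (hρ : ContDiff ℝ (⊤ : ℕ∞) ρ) (q : ℝ) : Continuous (cq ρ q) := by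
  have := hρ.continuous
  unfold cq; fun_prop

lemma cq'_continuous (ρ : ℝ → ℝ) (hρ : ContDiff ℝ (⊤ : ℕ∞) ρ) (q : ℝ) : Continuous (cq' ρ q) := by
  have : Continuous (deriv ρ) := hρ.continuous_deriv (by simp)
  unfold cq'; fun_prop

lemma hprof_continuous (ρ : ℝ → ℝ) (hρ : ContDiff ℝ (⊤ : ℕ∞) ρ) (γ q t : ℝ) :
    Continuous (hprof ρ γ q t) := by
  have h1 := jw_continuous
  have h2 := jw_rpow_continuous (-γ)
  have h3 := cq_continuous ρ hρ q
  unfold hprof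
  fun_prop

lemma cq_zero_large (ρ : ℝ → ℝ) (hρsupp : Function.support ρ ⊆ Set.Ioo (-2) 2) (q : ℝ) (hq : 0 < q)
    (s : ℝ) (hs : 4 * q ≤ s) : cq ρ q s = 0 := by
  have h0 : ∀ u, 2 ≤ u → ρ u = 0 := by
    intro u hu
    by_contra hne
    exact absurd (hρsupp hne).2 (not_lt.2 hu)
  rw [cq, h0, h0, sub_zero]
  · rw [div_mul_eq_mul_div, le_div_iff₀ hq]; linarith
  · rw [div_mul_eq_mul_div, le_div_iff₀ (by positivity)]; linarith

lemma cq_zero_small (ρ : ℝ → ℝ) (hρ1 : ∀ s : ℝ, |s| ≤ 1 → ρ s = 1) (q : ℝ) (hq : 0 < q)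
    (s : ℝ) (hs0 : 0 ≤ s) (hs : s ≤ q / 4) : cq ρ q s = 0 := by
  rw [cq, hρ1, hρ1, sub_self]
  · rw [abs_of_nonneg (by positivity), div_mul_eq_mul_div, div_le_iff₀ hq]; linarith
  · rw [abs_of_nonneg (by positivity), div_mul_eq_mul_div, div_le_iff₀ (by positivity)]; linarith

lemma cq'_zero_small (ρ : ℝ → ℝ) (hρ1 : ∀ s : ℝ, |s| ≤ 1 → ρ s = 1) (q : ℝ) (hq : 0 < q)
    (s : ℝ) (hs0 : 0 ≤ s) (hs : s < q / 4) : cq' ρ q s = 0 := by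
  have h0 : ∀ u, |u| < 1 → deriv ρ u = 0 := by
    intro u hu
    have : ρ =ᶠ[nhds u] fun _ => 1 := by
      have ho : IsOpen {v : ℝ | |v| < 1} := isOpen_lt continuous_abs continuous_const
      filter_upwards [ho.mem_nhds hu] with v hv using hρ1 v (le_of_lt hv)
    rw [this.deriv_eq, deriv_const]
  rw [cq', h0, h0]
  · simp
  · rw [abs_of_nonneg (by positivity), div_mul_eq_mul_div, div_lt_iff₀ hq]; linarith
  · rw [abs_of_nonneg (by positivity), div_mul_eq_mul_div, div_lt_iff₀ (by positivity)]; linarith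

lemma cq_bound (ρ : ℝ → ℝ) (M : ℝ) (hM : ∀ u, |ρ u| ≤ M) (q s : ℝ) : |cq ρ q s| ≤ 2 * M := by
  have := abs_sub (ρ (1 / (2 * q) * s)) (ρ (4 / q * s))
  unfold cq
  linarith [hM (1 / (2 * q) * s), hM (4 / q * s)]

lemma cq'_bound (ρ : ℝ → ℝ) (M : ℝ) (hM : ∀ u, |deriv ρ u| ≤ M) (q s : ℝ) (hq : 0 < q)
    (hs0 : 0 ≤ s) (hs : s ≤ 4 * q) : s * |cq' ρ q s| ≤ 18 * M := by
  have hM0 : 0 ≤ M := (abs_nonneg _).trans (hM 0)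
  have h1 : |cq' ρ q s| ≤ 1 / (2 * q) * M + 4 / q * M := by
    unfold cq'
    refine (abs_sub _ _).trans ?_
    rw [abs_mul, abs_mul, abs_of_pos (show 0 < 1 / (2 * q) by positivity),
      abs_of_pos (show 0 < 4 / q by positivity)]
    gcongr <;> exact hM _
  calc s * |cq' ρ q s| ≤ (4 * q) * (1 / (2 * q) * M + 4 / q * M) := by gcongr
    _ = 18 * M := by field_simp; ring

lemma sin_div_le (r s : ℝ) (hr : 0 < r) (hs : 0 ≤ s) : |Real.sin (r * s) / r| ≤ s := by
  rw [abs_div, abs_of_pos hr, div_le_iff₀ hr]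
  calc |Real.sin (r * s)| ≤ |r * s| := Real.abs_sin_le_abs
    _ = s * r := by rw [abs_of_nonneg (by positivity)]; ring

lemma jw_mul_rpow_le (γ s : ℝ) (hs : 0 ≤ s) : s * jw s ^ (-γ) ≤ jw s ^ (1 - γ) := by
  have h1 : jw s ^ (1 - γ) = jw s * jw s ^ (-γ) := by
    rw [sub_eq_add_neg, Real.rpow_add (jw_pos s), Real.rpow_one]
  rw [h1]
  have := (le_abs_self s).trans (jw_abs_le s)
  have := Real.rpow_nonneg (jw_pos s).le (-γ)
  gcongr

lemma norm_expI (a : ℝ) : ‖Complex.exp (I * (a : ℂ))‖ = 1 := by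
  rw [mul_comm]; exact Complex.norm_exp_ofReal_mul_I a

lemma Ioi_to_interval (ρ : ℝ → ℝ) (hρsupp : Function.support ρ ⊆ Set.Ioo (-2) 2)
    (γ q t r : ℝ) (hq : 0 < q) :
    ∫ s in Set.Ioi (0 : ℝ), ((Real.sin (r * s) / r * s : ℝ) : ℂ) * hprof ρ γ q t s =
    ∫ s in (0 : ℝ)..(4 * q), ((Real.sin (r * s) / r * s : ℝ) : ℂ) * hprof ρ γ q t s := by
  rw [intervalIntegral.integral_of_le (by positivity)]
  refine setIntegral_eq_of_subset_of_forall_sdiff_eq_zero measurableSet_Ioi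
    (fun s hs => hs.1) ?_
  intro s hs
  have h1 : 4 * q < s := by
    by_contra hcon
    exact hs.2 ⟨hs.1, not_lt.1 hcon⟩
  simp [hprof, cq_zero_large ρ hρsupp q hq s h1.le]

/-- The two trivial bounds. -/
lemma osc_trivial (ρ : ℝ → ℝ) (hρsupp : Function.support ρ ⊆ Set.Ioo (-2) 2)
    (hρ1 : ∀ s : ℝ, |s| ≤ 1 → ρ s = 1)
    (M : ℝ) (hM : ∀ u, |ρ u| ≤ M)
    (γ q t r β X : ℝ) (hq : 0 < q) (hr : 0 < r) (hβ : ∀ s, q / 4 ≤ s → jw s ^ (1 - γ) ≤ β)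
    (hX : X = 4 * q ∨ X = 1 / r) :
    ‖∫ s in Set.Ioi (0 : ℝ), ((Real.sin (r * s) / r * s : ℝ) : ℂ) * hprof ρ γ q t s‖
      ≤ X * (β * (2 * M)) * (4 * q) := by
  have hM0 : 0 ≤ M := (abs_nonneg _).trans (hM 0)
  have hβ0 : 0 ≤ β := (Real.rpow_nonneg (jw_pos (q/4)).le _).trans (hβ (q / 4) le_rfl)
  have hX0 : 0 ≤ X := by rcases hX with h | h <;> rw [h] <;> positivity
  rw [Ioi_to_interval ρ hρsupp γ q t r hq]
  have key : ∀ s ∈ Set.uIoc 0 (4 * q),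
      ‖((Real.sin (r * s) / r * s : ℝ) : ℂ) * hprof ρ γ q t s‖ ≤ X * (β * (2 * M)) := by
    intro s hs
    rw [Set.uIoc_of_le (by positivity)] at hs
    rcases lt_or_ge s (q / 4) with h1 | h1
    · simp [hprof, cq_zero_small ρ hρ1 q hq s hs.1.le h1.le]
      positivity
    · have hsX : |Real.sin (r * s) / r| ≤ X := by
        rcases hX with h | h
        · rw [h]; exact (sin_div_le r s hr hs.1.le).trans hs.2
        · rw [h, abs_div, abs_of_pos hr]
          gcongr
          exact Real.abs_sin_le_one _
      have e : ‖((Real.sin (r * s) / r * s : ℝ) : ℂ) * hprof ρ γ q t s‖ =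
          |Real.sin (r * s) / r| * ((s * jw s ^ (-γ)) * |cq ρ q s|) := by
        rw [hprof, norm_mul, norm_mul, norm_expI, Complex.norm_real, Complex.norm_real,
          Real.norm_eq_abs, Real.norm_eq_abs, abs_mul, abs_mul, abs_of_pos hs.1,
          abs_of_nonneg (Real.rpow_nonneg (jw_pos s).le _)]
        ring
      rw [e]
      have h2 := (jw_mul_rpow_le γ s hs.1.le).trans (hβ s h1)
      have h3 := cq_bound ρ M hM q s
      have p2 : 0 ≤ s * jw s ^ (-γ) := mul_nonneg hs.1.le (Real.rpow_nonneg (jw_pos s).le _)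
      have p3 := mul_nonneg p2 (abs_nonneg (cq ρ q s))
      gcongr
  have := intervalIntegral.norm_integral_le_of_norm_le_const key
  rwa [sub_zero, abs_of_pos (by positivity)] at this

/-- The bound from integration by parts. -/
lemma osc_parts (ρ : ℝ → ℝ) (hρ : ContDiff ℝ (⊤ : ℕ∞) ρ)
    (hρsupp : Function.support ρ ⊆ Set.Ioo (-2) 2)
    (hρ1 : ∀ s : ℝ, |s| ≤ 1 → ρ s = 1)
    (M : ℝ) (hM : ∀ u, |ρ u| ≤ M) (hM' : ∀ u, |deriv ρ u| ≤ M)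
    (γ q t r β : ℝ) (hγ : 1 ≤ γ) (hq : 0 < q) (hr : 0 < r) (ht : t ≠ 0)
    (hβ : ∀ s, q / 4 ≤ s → jw s ^ (1 - γ) ≤ β) :
    ‖∫ s in Set.Ioi (0 : ℝ), ((Real.sin (r * s) / r * s : ℝ) : ℂ) * hprof ρ γ q t s‖
      ≤ 1 / |t| * (β * ((20 + 2 * γ) * M)) * (4 * q) := by
  have hM0 : 0 ≤ M := (abs_nonneg _).trans (hM 0)
  have hβ0 : 0 ≤ β := (Real.rpow_nonneg (jw_pos (q/4)).le _).trans (hβ (q / 4) le_rfl)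
  rw [Ioi_to_interval ρ hρsupp γ q t r hq]
  set G : ℝ → ℝ := fun s => Real.sin (r * s) / r * (jw s ^ (1 - γ) * cq ρ q s) with hG
  set G' : ℝ → ℝ := fun s => Real.cos (r * s) * (jw s ^ (1 - γ) * cq ρ q s) +
    Real.sin (r * s) / r * ((1 - γ) * jw s ^ (-γ) * (s / jw s) * cq ρ q s +
      jw s ^ (1 - γ) * cq' ρ q s) with hG'
  set E : ℝ → ℂ := fun s => Complex.exp (I * ((t * jw s : ℝ) : ℂ)) with hE
  set E' : ℝ → ℂ := fun s => Complex.exp (I * ((t * jw s : ℝ) : ℂ)) *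
    (I * ((t * (s / jw s) : ℝ) : ℂ)) with hE'
  have dG : ∀ s, HasDerivAt G (G' s) s := by
    intro s
    have d1 : HasDerivAt (fun s => Real.sin (r * s) / r) (Real.cos (r * s)) s := by
      have := (((hasDerivAt_id s).const_mul r).sin).div_const r
      refine this.congr_deriv ?_
      simp [hr.ne']
    have d2 : HasDerivAt (fun s => jw s ^ (1 - γ)) ((1 - γ) * jw s ^ (-γ) * (s / jw s)) s := by
      have := (jw_hasDerivAt s).rpow_const (p := 1 - γ) (Or.inl (jw_pos s).ne')
      refine this.congr_deriv ?_
      rw [show 1 - γ - 1 = -γ by ring]; ring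
    exact d1.mul (d2.mul (cq_hasDerivAt ρ hρ q s))
  have dE : ∀ s, HasDerivAt E (E' s) s := by
    intro s
    have := (((jw_hasDerivAt s).const_mul t).ofReal_comp.const_mul I).cexp
    exact this
  have cw := jw_continuous
  have cw1 := jw_rpow_continuous (1 - γ)
  have cw2 := jw_rpow_continuous (-γ)
  have cc := cq_continuous ρ hρ q
  have cc' := cq'_continuous ρ hρ q
  have cdiv : Continuous (fun s => s / jw s) := continuous_id.div cw (fun s => (jw_pos s).ne')
  have cG' : Continuous G' := by rw [hG']; fun_prop
  have cE' : Continuous E' := by rw [hE']; fun_prop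
  have ibp := intervalIntegral.integral_mul_deriv_eq_deriv_mul (a := 0) (b := 4 * q)
    (u := fun s => (G s : ℂ)) (u' := fun s => (G' s : ℂ)) (v := E) (v' := E')
    (fun s _ => (dG s).ofReal_comp) (fun s _ => dE s)
    ((Complex.continuous_ofReal.comp cG').intervalIntegrable _ _) (cE'.intervalIntegrable _ _)
  have hG0 : G 0 = 0 := by simp [hG]
  have hGb : G (4 * q) = 0 := by simp [hG, cq_zero_large ρ hρsupp q hq (4 * q) le_rfl]
  rw [hG0, hGb] at ibp
  simp only [Complex.ofReal_zero, zero_mul, sub_zero, zero_sub] at ibp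
  have htc : (t : ℂ) ≠ 0 := by exact_mod_cast ht
  have e1 : ∀ s, ((Real.sin (r * s) / r * s : ℝ) : ℂ) * hprof ρ γ q t s =
      (1 / (I * t)) * ((G s : ℂ) * E' s) := by
    intro s
    have hw := (jw_pos s).ne'
    have hwc : (jw s : ℂ) ≠ 0 := by exact_mod_cast hw
    have h1 : jw s ^ (1 - γ) = jw s * jw s ^ (-γ) := by
      rw [sub_eq_add_neg, Real.rpow_add (jw_pos s), Real.rpow_one]
    simp only [hprof, hG, hE', h1]
    push_cast
    have hIt : I * (t : ℂ) ≠ 0 := mul_ne_zero I_ne_zero htc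
    rw [eq_comm, one_div, inv_mul_eq_iff_eq_mul₀ hIt]
    field_simp
  simp only [e1]
  rw [intervalIntegral.integral_const_mul, ibp, norm_mul, norm_neg]
  have key : ∀ s ∈ Set.uIoc 0 (4 * q), ‖(G' s : ℂ) * E s‖ ≤ β * ((20 + 2 * γ) * M) := by
    intro s hs
    rw [Set.uIoc_of_le (by positivity)] at hs
    have e2 : ‖(G' s : ℂ) * E s‖ = |G' s| := by
      rw [hE, norm_mul, norm_expI, Complex.norm_real, mul_one, Real.norm_eq_abs]
    rw [e2]
    rcases lt_or_ge s (q / 4) with h1 | h1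
    · simp [hG', cq_zero_small ρ hρ1 q hq s hs.1.le h1.le, cq'_zero_small ρ hρ1 q hq s hs.1.le h1]
      positivity
    · have hb := hβ s h1
      have h3 := cq_bound ρ M hM q s
      have h4 := cq'_bound ρ M hM' q s hq hs.1.le hs.2
      have h5 := sin_div_le r s hr hs.1.le
      have h6 := (jw_mul_rpow_le γ s hs.1.le).trans hb
      have p1 : 0 ≤ jw s ^ (1 - γ) := Real.rpow_nonneg (jw_pos s).le _
      have p2 : 0 ≤ jw s ^ (-γ) := Real.rpow_nonneg (jw_pos s).le _
      have h7 : |s / jw s| ≤ 1 := by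
        rw [abs_div, abs_of_pos (jw_pos s), div_le_one (jw_pos s)]; exact jw_abs_le s
      have b1 : |Real.cos (r * s) * (jw s ^ (1 - γ) * cq ρ q s)| ≤ 1 * (β * (2 * M)) := by
        rw [abs_mul, abs_mul, abs_of_nonneg p1]
        gcongr
        exact Real.abs_cos_le_one _
      have b2 : |Real.sin (r * s) / r * ((1 - γ) * jw s ^ (-γ) * (s / jw s) * cq ρ q s)| ≤
          β * ((γ - 1) * (1 * (2 * M))) := by
        have e : |Real.sin (r * s) / r * ((1 - γ) * jw s ^ (-γ) * (s / jw s) * cq ρ q s)| =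
          (|Real.sin (r * s) / r| * jw s ^ (-γ)) * ((γ - 1) * (|s / jw s| * |cq ρ q s|)) := by
          rw [abs_mul, abs_mul, abs_mul, abs_mul (1 - γ), abs_of_nonneg p2,
            abs_of_nonpos (show 1 - γ ≤ 0 by linarith)]
          ring
        rw [e]
        have hg : 0 ≤ γ - 1 := by linarith
        have : |Real.sin (r * s) / r| * jw s ^ (-γ) ≤ β := le_trans (by gcongr) h6
        gcongr
      have b3 : |Real.sin (r * s) / r * (jw s ^ (1 - γ) * cq' ρ q s)| ≤ β * (18 * M) := by
        have e : |Real.sin (r * s) / r * (jw s ^ (1 - γ) * cq' ρ q s)| =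
          jw s ^ (1 - γ) * (|Real.sin (r * s) / r| * |cq' ρ q s|) := by
          rw [abs_mul, abs_mul, abs_of_nonneg p1]; ring
        rw [e]
        have : |Real.sin (r * s) / r| * |cq' ρ q s| ≤ 18 * M := le_trans (by gcongr) h4
        gcongr
      have e3 : G' s = Real.cos (r * s) * (jw s ^ (1 - γ) * cq ρ q s) +
        Real.sin (r * s) / r * ((1 - γ) * jw s ^ (-γ) * (s / jw s) * cq ρ q s) +
        Real.sin (r * s) / r * (jw s ^ (1 - γ) * cq' ρ q s) := by
        simp only [hG']; ring
      rw [e3]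
      refine (abs_add_three _ _ _).trans ?_
      nlinarith
  have := intervalIntegral.norm_integral_le_of_norm_le_const key
  rw [sub_zero, abs_of_pos (by positivity)] at this
  have e4 : ‖(1 / (I * (t : ℂ)))‖ = 1 / |t| := by simp
  rw [e4, mul_assoc]
  gcongr

lemma Kloc_eq (ρ : ℝ → ℝ) (γ : ℝ) (k : ℤ) (x : EuclideanSpace ℝ (Fin 3)) (t : ℝ) :
    Kloc ρ γ k x t = ∫ ξ : EuclideanSpace ℝ (Fin 3),
      Complex.exp (I * ((dotE x ξ : ℝ) : ℂ)) * hprof ρ γ ((2 : ℝ) ^ k) t ‖ξ‖ := by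
  unfold Kloc
  refine integral_congr_ae (Filter.Eventually.of_forall fun ξ => ?_)
  have h2 : (2 : ℝ) ≠ 0 := two_ne_zero
  have e1 : (2 : ℝ) ^ (-(k + 1)) = 1 / (2 * 2 ^ k) := by
    rw [zpow_neg, zpow_add₀ h2, zpow_one, one_div, mul_comm]
  have e2 : (2 : ℝ) ^ (-(k - 2)) = 4 / 2 ^ k := by
    rw [neg_sub, zpow_sub₀ h2]; norm_num
  simp only [hprof, chiLP, cq, e1, e2]
  rw [← mul_assoc, ← Complex.exp_add]
  simp only [jap, jw]
  push_cast
  congr 3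
  ring

lemma jw_beta (γ : ℝ) (hγ : 1 ≤ γ) (q s : ℝ) (hq : 0 < q) (hs : q / 4 ≤ s) :
    jw s ^ (1 - γ) ≤ (4 : ℝ) ^ (γ - 1) * min 1 (q ^ (1 - γ)) := by
  rw [mul_min_of_nonneg _ _ (by positivity)]
  apply le_min
  · rw [mul_one]
    calc jw s ^ (1 - γ) ≤ 1 := Real.rpow_le_one_of_one_le_of_nonpos (jw_one_le s) (by linarith)
      _ ≤ 4 ^ (γ - 1) := Real.one_le_rpow (by norm_num) (by linarith)
  · have h1 : q / 4 ≤ jw s := hs.trans ((le_abs_self s).trans (jw_abs_le s))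
    calc jw s ^ (1 - γ) ≤ (q / 4) ^ (1 - γ) :=
          Real.rpow_le_rpow_of_nonpos (by positivity) h1 (by linarith)
      _ = 4 ^ (γ - 1) * q ^ (1 - γ) := by
          rw [Real.div_rpow hq.le (by norm_num), show γ - 1 = -(1 - γ) by ring,
            Real.rpow_neg (by norm_num)]
          field_simp

lemma exists_M (ρ : ℝ → ℝ) (hρ : ContDiff ℝ (⊤ : ℕ∞) ρ)
    (hρsupp : Function.support ρ ⊆ Set.Ioo (-2) 2) :
    ∃ M : ℝ, (∀ u, |ρ u| ≤ M) ∧ (∀ u, |deriv ρ u| ≤ M) := by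
  have hcs : HasCompactSupport ρ := by
    apply HasCompactSupport.intro (isCompact_Icc (a := (-2 : ℝ)) (b := 2))
    intro y hy
    by_contra hne
    exact hy (Set.Ioo_subset_Icc_self (hρsupp hne))
  obtain ⟨M1, h1⟩ := hρ.continuous.bounded_above_of_compact_support hcs
  obtain ⟨M2, h2⟩ := (hρ.continuous_deriv (by simp)).bounded_above_of_compact_support hcs.deriv
  exact ⟨max M1 M2, fun u => (h1 u).trans (le_max_left _ _),
    fun u => (h2 u).trans (le_max_right _ _)⟩

lemma Kloc_bound (γ : ℝ) (hγ : 2 < γ) (ρ : ℝ → ℝ)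
    (hρ : ContDiff ℝ (⊤ : ℕ∞) ρ) (hρsupp : Function.support ρ ⊆ Set.Ioo (-2) 2)
    (hρ1 : ∀ s : ℝ, |s| ≤ 1 → ρ s = 1) :
    ∃ C : ℝ, 0 ≤ C ∧ ∀ (k : ℤ) (x : EuclideanSpace ℝ (Fin 3)) (t : ℝ), x ≠ 0 → t ≠ 0 →
      ‖Kloc ρ γ k x t‖ ≤ C * (((2 : ℝ) ^ k * min 1 (((2 : ℝ) ^ k) ^ (1 - γ))) *
        min ((2 : ℝ) ^ k) (1 / (‖x‖ + |t|))) := by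
  obtain ⟨M, hM, hM'⟩ := exists_M ρ hρ hρsupp
  have hM0 : 0 ≤ M := (abs_nonneg _).trans (hM 0)
  set V : ℝ := 4 * (volume : Measure (EuclideanSpace ℝ (Fin 2))).real (Metric.ball 0 1) with hV
  have hV0 : 0 ≤ V := by positivity
  set D : ℝ := (20 + 2 * γ) * M with hD
  have hD0 : 0 ≤ D := by positivity
  refine ⟨V * (4 ^ (γ - 1) * D * 16), by positivity, ?_⟩
  intro k x t hx ht
  have hr : 0 < ‖x‖ := norm_pos_iff.2 hx
  have ht' : 0 < |t| := abs_pos.2 ht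
  set q : ℝ := (2 : ℝ) ^ k with hq
  have hq0 : 0 < q := by positivity
  set m : ℝ := min 1 (q ^ (1 - γ)) with hm
  have hm0 : 0 ≤ m := by positivity
  rw [Kloc_eq, rad_formula _ (hprof_continuous ρ hρ γ _ t) (4 * q) (by positivity) _ x hx]
  · rw [norm_mul, Complex.norm_real, Real.norm_eq_abs, ← hV, abs_of_nonneg hV0]
    set J := ‖∫ s in Set.Ioi (0 : ℝ), ((Real.sin (‖x‖ * s) / ‖x‖ * s : ℝ) : ℂ) * hprof ρ γ q t s‖
    have hβ : ∀ s, q / 4 ≤ s → jw s ^ (1 - γ) ≤ 4 ^ (γ - 1) * m := fun s hs =>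
      jw_beta γ (by linarith) q s hq0 hs
    have hDM : 2 * M ≤ D := by rw [hD]; nlinarith
    have j1 : J ≤ (4 * q) * (4 ^ (γ - 1) * m * D) * (4 * q) :=
      (osc_trivial ρ hρsupp hρ1 M hM γ q t ‖x‖ _ (4 * q) hq0 hr hβ (Or.inl rfl)).trans (by gcongr)
    have j2 : J ≤ (1 / ‖x‖) * (4 ^ (γ - 1) * m * D) * (4 * q) :=
      (osc_trivial ρ hρsupp hρ1 M hM γ q t ‖x‖ _ (1 / ‖x‖) hq0 hr hβ (Or.inr rfl)).trans
        (by gcongr)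
    have j3 : J ≤ (1 / |t|) * (4 ^ (γ - 1) * m * D) * (4 * q) :=
      osc_parts ρ hρ hρsupp hρ1 M hM hM' γ q t ‖x‖ _ (by linarith) hq0 hr ht hβ
    have j4 : J ≤ (4 * min q (1 / (‖x‖ + |t|))) * (4 ^ (γ - 1) * m * D) * (4 * q) := by
      rcases min_choice q (1 / (‖x‖ + |t|)) with h | h
      · rw [h]; exact j1
      · rw [h]
        rcases le_total ‖x‖ |t| with h1 | h1
        · refine j3.trans ?_
          gcongr
          rw [mul_one_div, div_le_div_iff₀ ht' (by positivity)]
          linarith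
        · refine j2.trans ?_
          gcongr
          rw [mul_one_div, div_le_div_iff₀ hr (by positivity)]
          linarith
    calc V * J ≤ V * ((4 * min q (1 / (‖x‖ + |t|))) * (4 ^ (γ - 1) * m * D) * (4 * q)) := by gcongr
      _ = _ := by ring
  · intro s hs
    rw [hprof, cq_zero_large ρ hρsupp q hq0 s hs]
    simp

lemma summable_int_of_two_sided (f : ℤ → ℝ) (hf : ∀ k, 0 ≤ f k) (α β : ℝ) (hα : 0 < α) (hβ : 0 < β)
    (h1 : ∀ k : ℤ, f k ≤ ((2 : ℝ) ^ k) ^ α) (h2 : ∀ k : ℤ, f k ≤ ((2 : ℝ) ^ k) ^ (-β)) :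
    Summable f := by
  have e : ∀ (k : ℤ) (a : ℝ), ((2 : ℝ) ^ k) ^ a = ((2 : ℝ) ^ a) ^ k := by
    intro k a
    rw [← Real.rpow_intCast, ← Real.rpow_mul (by norm_num), mul_comm, Real.rpow_mul (by norm_num),
      Real.rpow_intCast]
  apply Summable.of_nat_of_neg
  · refine Summable.of_nonneg_of_le (fun n => hf n) (fun n => h2 n) ?_
    have e' : (fun n : ℕ => ((2 : ℝ) ^ (n : ℤ)) ^ (-β)) = fun n : ℕ => ((2 : ℝ) ^ (-β)) ^ n := by
      funext n
      rw [e, zpow_natCast]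
    rw [e']
    refine summable_geometric_of_lt_one (Real.rpow_nonneg (by norm_num) _) ?_
    exact Real.rpow_lt_one_of_one_lt_of_neg (by norm_num) (by linarith)
  · refine Summable.of_nonneg_of_le (fun n => hf _) (fun n => h1 _) ?_
    have e' : (fun n : ℕ => ((2 : ℝ) ^ (-(n : ℤ))) ^ α) = fun n : ℕ => (((2 : ℝ) ^ α)⁻¹) ^ n := by
      funext n
      rw [e, zpow_neg, zpow_natCast, inv_pow]
    rw [e']
    refine summable_geometric_of_lt_one (inv_nonneg.2 (Real.rpow_nonneg (by norm_num) _)) ?_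
    exact inv_lt_one_of_one_lt₀ (Real.one_lt_rpow (by norm_num) hα)

lemma Kker_bound (γ : ℝ) (hγ : 2 < γ) (ρ : ℝ → ℝ)
    (hρ : ContDiff ℝ (⊤ : ℕ∞) ρ) (hρsupp : Function.support ρ ⊆ Set.Ioo (-2) 2)
    (hρ1 : ∀ s : ℝ, |s| ≤ 1 → ρ s = 1) (a : ℝ) (ha0 : 0 < a) (ha1 : a ≤ 1) (haγ : 3 - γ ≤ a) :
    ∃ C : ℝ, 0 ≤ C ∧ ∀ (x : EuclideanSpace ℝ (Fin 3)) (t : ℝ), x ≠ 0 → t ≠ 0 →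
      ‖Kker ρ γ x t‖ ≤ C * (‖x‖ + |t|) ^ (-a) := by
  obtain ⟨C, hC, hK⟩ := Kloc_bound γ hγ ρ hρ hρsupp hρ1
  rcases haγ.lt_or_eq with hlt | heq
  · set T : ℤ → ℝ := fun k => ((2 : ℝ) ^ k * min 1 (((2 : ℝ) ^ k) ^ (1 - γ))) *
      ((2 : ℝ) ^ k) ^ (1 - a) with hT
    have hT0 : ∀ k, 0 ≤ T k := fun k => by positivity
    have hsum : Summable T := by
      refine summable_int_of_two_sided T hT0 (2 - a) (a - (3 - γ)) (by linarith) (by linarith) ?_ ?_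
      · intro k
        have hq0 : 0 < (2 : ℝ) ^ k := by positivity
        calc T k ≤ ((2 : ℝ) ^ k * 1) * ((2 : ℝ) ^ k) ^ (1 - a) := by
              simp only [hT]; gcongr; exact min_le_left _ _
          _ = _ := by
              rw [mul_one, show 2 - a = 1 + (1 - a) by ring, Real.rpow_add hq0, Real.rpow_one]
      · intro k
        have hq0 : 0 < (2 : ℝ) ^ k := by positivity
        calc T k ≤ ((2 : ℝ) ^ k * (((2 : ℝ) ^ k) ^ (1 - γ))) * ((2 : ℝ) ^ k) ^ (1 - a) := by
              simp only [hT]; gcongr; exact min_le_right _ _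
          _ = _ := by
              rw [show -(a - (3 - γ)) = 1 + (1 - γ) + (1 - a) by ring, Real.rpow_add hq0,
                Real.rpow_add hq0, Real.rpow_one]
    refine ⟨C * ∑' k, T k, mul_nonneg hC (tsum_nonneg hT0), ?_⟩
    intro x t hx ht
    have hR : 0 < ‖x‖ + |t| := by positivity
    have hs := (hsum.hasSum.mul_left C).mul_right ((‖x‖ + |t|) ^ (-a))
    refine tsum_of_norm_bounded hs ?_
    intro k
    refine (hK k x t hx ht).trans ?_
    simp only [hT]
    have hq0 : 0 < (2 : ℝ) ^ k := by positivity
    have hmin : min ((2 : ℝ) ^ k) (1 / (‖x‖ + |t|)) ≤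
        ((2 : ℝ) ^ k) ^ (1 - a) * (‖x‖ + |t|) ^ (-a) := by
      set m := min ((2 : ℝ) ^ k) (1 / (‖x‖ + |t|)) with hm
      have hm0 : 0 < m := by positivity
      have e1 : m = m ^ (1 - a) * m ^ a := by
        rw [← Real.rpow_add hm0]; simp
      have e2 : (‖x‖ + |t|) ^ (-a) = (1 / (‖x‖ + |t|)) ^ a := by
        rw [Real.rpow_neg hR.le, one_div, Real.inv_rpow hR.le]
      rw [e2, e1]
      have h1a : 0 ≤ 1 - a := by linarith
      gcongr
      · exact min_le_left _ _
      · exact min_le_right _ _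
    have hp : 0 ≤ (2 : ℝ) ^ k * min 1 (((2 : ℝ) ^ k) ^ (1 - γ)) := by positivity
    calc _ ≤ C * ((2 : ℝ) ^ k * min 1 (((2 : ℝ) ^ k) ^ (1 - γ)) *
        (((2 : ℝ) ^ k) ^ (1 - a) * (‖x‖ + |t|) ^ (-a))) :=
          mul_le_mul_of_nonneg_left (mul_le_mul_of_nonneg_left hmin hp) hC
      _ = _ := by ring
  · have haβ : 1 - a = γ - 2 := by linarith
    set U : ℤ → ℝ := fun k => min (((2 : ℝ) ^ k) ^ a) (((2 : ℝ) ^ k) ^ (-(γ - 2))) with hU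
    have hU0 : ∀ k, 0 ≤ U k := fun k => by positivity
    have hsum : Summable U :=
      summable_int_of_two_sided U hU0 a (γ - 2) ha0 (by linarith) (fun k => min_le_left _ _)
        (fun k => min_le_right _ _)
    refine ⟨2 * C * ∑' k, U k, mul_nonneg (by positivity) (tsum_nonneg hU0), ?_⟩
    intro x t hx ht
    have hR : 0 < ‖x‖ + |t| := by positivity
    obtain ⟨N, hN1, hN2⟩ := exists_mem_Ico_zpow (show 0 < 1 / (‖x‖ + |t|) by positivity)
      (show (1 : ℝ) < 2 by norm_num)
    have hs0 : HasSum (fun k => U (k - N)) (∑' k, U k) := by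
      have := (Equiv.subRight N).hasSum_iff.2 hsum.hasSum
      exact this
    have hs := (hs0.mul_left (2 * C)).mul_right ((‖x‖ + |t|) ^ (-a))
    refine tsum_of_norm_bounded hs ?_
    intro k
    refine (hK k x t hx ht).trans ?_
    obtain ⟨j, rfl⟩ : ∃ j, k = j + N := ⟨k - N, by ring⟩
    rw [add_sub_cancel_right]
    set A : ℝ := (2 : ℝ) ^ j with hA
    set B : ℝ := (2 : ℝ) ^ N with hB
    have hA0 : 0 < A := by positivity
    have hB0 : 0 < B := by positivity
    rw [zpow_add₀ two_ne_zero, ← hA, ← hB]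
    have e2 : (‖x‖ + |t|) ^ (-a) = (1 / (‖x‖ + |t|)) ^ a := by
      rw [Real.rpow_neg hR.le, one_div, Real.inv_rpow hR.le]
    rw [e2]
    have hN2' : 1 / (‖x‖ + |t|) ≤ 2 * B := by
      rw [zpow_add₀ two_ne_zero, zpow_one] at hN2; linarith
    have s1 : min (A * B) (1 / (‖x‖ + |t|)) ≤ 2 * (B * min A 1) := by
      rw [mul_min_of_nonneg _ _ hB0.le, mul_min_of_nonneg _ _ (by norm_num)]
      apply min_le_min
      · nlinarith [mul_pos hA0 hB0]
      · linarith
    have s2 : A * B * min 1 ((A * B) ^ (1 - γ)) ≤ A ^ (-(γ - 2)) * B ^ (-(γ - 2)) := by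
      calc A * B * min 1 ((A * B) ^ (1 - γ)) ≤ A * B * (A * B) ^ (1 - γ) := by
            gcongr; exact min_le_right _ _
        _ = (A * B) ^ (-(γ - 2)) := by
            rw [show -(γ - 2) = 1 + (1 - γ) by ring, Real.rpow_add (by positivity), Real.rpow_one]
        _ = _ := Real.mul_rpow hA0.le hB0.le
    have s3 : A ^ (-(γ - 2)) * min A 1 = U j := by
      simp only [hU]
      rw [mul_min_of_nonneg _ _ (by positivity), mul_one]
      congr 1
      rw [show a = -(γ - 2) + 1 by linarith, Real.rpow_add hA0, Real.rpow_one]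
    have s4 : B ^ (-(γ - 2)) * B ≤ (1 / (‖x‖ + |t|)) ^ a := by
      have : B ^ (-(γ - 2)) * B = B ^ a := by
        rw [show a = -(γ - 2) + 1 by linarith, Real.rpow_add hB0, Real.rpow_one]
      rw [this]
      gcongr
    calc C * (A * B * min 1 ((A * B) ^ (1 - γ)) * min (A * B) (1 / (‖x‖ + |t|)))
        ≤ C * ((A ^ (-(γ - 2)) * B ^ (-(γ - 2))) * (2 * (B * min A 1))) := by gcongr
      _ = 2 * C * (A ^ (-(γ - 2)) * min A 1) * (B ^ (-(γ - 2)) * B) := by ring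
      _ ≤ 2 * C * (A ^ (-(γ - 2)) * min A 1) * (1 / (‖x‖ + |t|)) ^ a := by gcongr
      _ = 2 * C * U j * (1 / (‖x‖ + |t|)) ^ a := by rw [s3]

lemma LpE_ofReal {α : Type*} [MeasurableSpace α] (μ : Measure α) (p : ℝ) (hp : 0 < p)
    (f : α → ℝ≥0∞) :
    LpE μ (ENNReal.ofReal p) f = (∫⁻ a, f a ^ p ∂μ) ^ (1 / p) := by
  unfold LpE
  rw [if_neg ENNReal.ofReal_ne_top, ENNReal.toReal_ofReal hp.le]

lemma LpE_mono_ae {α : Type*} [MeasurableSpace α] (μ : Measure α) (p : ℝ) (hp : 0 < p)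
    (f g : α → ℝ≥0∞) (h : ∀ᵐ a ∂μ, f a ≤ g a) :
    LpE μ (ENNReal.ofReal p) f ≤ LpE μ (ENNReal.ofReal p) g := by
  rw [LpE_ofReal μ p hp, LpE_ofReal μ p hp]
  refine ENNReal.rpow_le_rpow (lintegral_mono_ae ?_) (by positivity)
  filter_upwards [h] with a ha
  exact ENNReal.rpow_le_rpow ha hp.le

/-- Scaling of the Lebesgue norm of a homogeneous weight. -/
lemma lintegral_scale (b : ℝ) (hb : 3 < b) :
    ∃ A : ℝ, 0 ≤ A ∧ ∀ T : ℝ, 0 < T →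
      ∫⁻ x : EuclideanSpace ℝ (Fin 3), ENNReal.ofReal ((‖x‖ + T) ^ (-b)) =
        ENNReal.ofReal (A * T ^ (3 - b)) := by
  refine ⟨∫ x : EuclideanSpace ℝ (Fin 3), (1 + ‖x‖) ^ (-b),
    integral_nonneg (fun x => by positivity), ?_⟩
  intro T hT
  have hIntble : Integrable (fun x : EuclideanSpace ℝ (Fin 3) => (1 + ‖x‖) ^ (-b)) :=
    integrable_one_add_norm (by simpa using hb)
  have e : ∀ x : EuclideanSpace ℝ (Fin 3),
      (‖x‖ + T) ^ (-b) = T ^ (-b) * (1 + ‖T⁻¹ • x‖) ^ (-b) := by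
    intro x
    rw [← Real.mul_rpow hT.le (by positivity), norm_smul, norm_inv, Real.norm_eq_abs, abs_of_pos hT]
    congr 1
    field_simp
    ring
  simp only [e]
  rw [← ofReal_integral_eq_lintegral_ofReal]
  · rw [integral_const_mul, Measure.integral_comp_smul volume
      (fun x : EuclideanSpace ℝ (Fin 3) => (1 + ‖x‖) ^ (-b))]
    congr 1
    rw [finrank_euclideanSpace, Fintype.card_fin, smul_eq_mul, abs_of_pos (by positivity),
      show 3 - b = -b + 3 by ring, Real.rpow_add hT]
    norm_cast
    simp
    ring
  · exact (hIntble.comp_smul (inv_ne_zero hT.ne')).const_mul _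
  · exact Filter.Eventually.of_forall fun x => by positivity

lemma LpE_scale (a p : ℝ) (hp : 0 < p) (hap : 3 < a * p) :
    ∃ A : ℝ, 0 ≤ A ∧ ∀ (D T : ℝ) (f : EuclideanSpace ℝ (Fin 3) → ℝ≥0∞), 0 ≤ D → 0 < T →
      (∀ᵐ y, f y ≤ ENNReal.ofReal (D * (‖y‖ + T) ^ (-a))) →
      LpE volume (ENNReal.ofReal p) f ≤ ENNReal.ofReal (A * D * T ^ (3 / p - a)) := by
  obtain ⟨A, hA, h⟩ := lintegral_scale (a * p) hap
  refine ⟨A ^ (1 / p), by positivity, ?_⟩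
  intro D T f hD hT hf
  refine (LpE_mono_ae volume p hp _ _ hf).trans ?_
  rw [LpE_ofReal _ p hp]
  have e : ∀ y : EuclideanSpace ℝ (Fin 3), ENNReal.ofReal (D * (‖y‖ + T) ^ (-a)) ^ p =
      ENNReal.ofReal (D ^ p) * ENNReal.ofReal ((‖y‖ + T) ^ (-(a * p))) := by
    intro y
    rw [ENNReal.ofReal_rpow_of_nonneg (by positivity) hp.le, Real.mul_rpow hD (by positivity),
      ← Real.rpow_mul (by positivity), ENNReal.ofReal_mul (by positivity), neg_mul]
  simp only [e]
  rw [lintegral_const_mul' _ _ ENNReal.ofReal_ne_top, h T hT,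
    ← ENNReal.ofReal_mul (by positivity), ENNReal.ofReal_rpow_of_nonneg (by positivity)
      (by positivity)]
  apply le_of_eq
  congr 1
  rw [Real.mul_rpow (by positivity) (by positivity), Real.mul_rpow hA (by positivity),
    ← Real.rpow_mul hD, ← Real.rpow_mul hT.le, mul_one_div_cancel hp.ne', Real.rpow_one]
  have : (3 - a * p) * (1 / p) = 3 / p - a := by field_simp
  rw [this]
  ring

lemma LpE_unit_ball (q : ℝ) (hq : 0 < q) :
    ∃ B : ℝ, 0 ≤ B ∧ ∀ (D : ℝ) (y : EuclideanSpace ℝ (Fin 3))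
      (f : EuclideanSpace ℝ (Fin 3) → ℝ≥0∞), 0 ≤ D →
      (∀ᵐ x, f x ≤ (Metric.ball y 1).indicator (fun _ => ENNReal.ofReal D) x) →
      LpE volume (ENNReal.ofReal q) f ≤ ENNReal.ofReal (B * D) := by
  refine ⟨((volume : Measure (EuclideanSpace ℝ (Fin 3))).real (Metric.ball 0 1)) ^ (1 / q),
    by positivity, ?_⟩
  intro D y f hD hf
  refine (LpE_mono_ae volume q hq _ _ hf).trans ?_
  rw [LpE_ofReal _ q hq]
  have e : ∀ x, (Metric.ball y 1).indicator (fun _ => ENNReal.ofReal D) x ^ q =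
      (Metric.ball y 1).indicator (fun _ => ENNReal.ofReal (D ^ q)) x := by
    intro x
    by_cases hx : x ∈ Metric.ball y 1
    · rw [Set.indicator_of_mem hx, Set.indicator_of_mem hx,
        ENNReal.ofReal_rpow_of_nonneg hD hq.le]
    · rw [Set.indicator_of_notMem hx, Set.indicator_of_notMem hx, ENNReal.zero_rpow_of_pos hq]
  simp only [e]
  rw [lintegral_indicator measurableSet_ball, setLIntegral_const,
    Measure.addHaar_ball_center volume y 1, Measure.real]
  have hfin : volume (Metric.ball (0 : EuclideanSpace ℝ (Fin 3)) 1) ≠ ∞ :=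
    measure_ball_lt_top.ne
  conv_lhs => rw [← ENNReal.ofReal_toReal hfin]
  rw [← ENNReal.ofReal_mul (by positivity), ENNReal.ofReal_rpow_of_nonneg (by positivity)
      (by positivity), Real.mul_rpow (by positivity) (by positivity), ← Real.rpow_mul hD,
      mul_one_div_cancel hq.ne', Real.rpow_one, mul_comm]

lemma LpE_local_finite (a q D : ℝ) (hq : 0 < q) (hD : 0 ≤ D) (haq : a * q < 3) :
    LpE volume (ENNReal.ofReal q) ((Metric.ball (0 : EuclideanSpace ℝ (Fin 3)) 3).indicator
      (fun x => ENNReal.ofReal (D * ‖x‖ ^ (-a)))) < ∞ := by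
  rw [LpE_ofReal _ q hq]
  apply ENNReal.rpow_lt_top_of_nonneg (by positivity)
  have e : ∀ x, (Metric.ball (0 : EuclideanSpace ℝ (Fin 3)) 3).indicator
      (fun x => ENNReal.ofReal (D * ‖x‖ ^ (-a))) x ^ q =
      (Metric.ball (0 : EuclideanSpace ℝ (Fin 3)) 3).indicator
      (fun x => ENNReal.ofReal (D ^ q * ‖x‖ ^ (-(a * q)))) x := by
    intro x
    by_cases hx : x ∈ Metric.ball (0 : EuclideanSpace ℝ (Fin 3)) 3
    · rw [Set.indicator_of_mem hx, Set.indicator_of_mem hx,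
        ENNReal.ofReal_rpow_of_nonneg (by positivity) hq.le,
        Real.mul_rpow hD (by positivity), ← Real.rpow_mul (by positivity), neg_mul]
    · rw [Set.indicator_of_notMem hx, Set.indicator_of_notMem hx, ENNReal.zero_rpow_of_pos hq]
  simp only [e]
  rw [lintegral_indicator measurableSet_ball]
  have hIntble : IntegrableOn (fun x : EuclideanSpace ℝ (Fin 3) =>
      (fun s : ℝ => D ^ q * s ^ (-(a * q))) ‖x‖) (Metric.ball 0 3) := by
    rw [integrableOn_fun_norm_addHaar volume (f := fun s : ℝ => D ^ q * s ^ (-(a * q)))]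
    have h1 : IntegrableOn (fun s : ℝ => D ^ q * s ^ (2 - a * q)) (Set.Ioo 0 3) :=
      ((intervalIntegral.integrableOn_Ioo_rpow_iff (by norm_num)).2 (by linarith)).const_mul _
    refine h1.congr_fun ?_ measurableSet_Ioo
    intro s hs
    simp only [finrank_euclideanSpace, Fintype.card_fin, smul_eq_mul]
    rw [sub_eq_add_neg, Real.rpow_add hs.1]
    norm_num
    ring
  exact (hIntble.lintegral_lt_top).ne

/-- Almost every point of `ℝ³` is nonzero. -/
lemma ae_ne_zero_E3 : ∀ᵐ x : EuclideanSpace ℝ (Fin 3), x ≠ 0 := by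
  have h : (volume : Measure (EuclideanSpace ℝ (Fin 3))) {0} = 0 := measure_singleton 0
  exact compl_mem_ae_iff.mpr h

/-- Local bound of the kernel on a fixed ball. -/
lemma Kker_local (γ q M : ℝ) (hγ : 2 < γ) (hq : 3 < q) (hne : (3 - γ) * q ≠ 3) (hM : 0 ≤ M)
    (ρ : ℝ → ℝ)
    (hρ : ContDiff ℝ (⊤ : ℕ∞) ρ) (hρsupp : Function.support ρ ⊆ Set.Ioo (-2) 2)
    (hρ1 : ∀ s : ℝ, |s| ≤ 1 → ρ s = 1) :
    ∃ L : ℝ, 0 ≤ L ∧ ∀ (t : ℝ) (f : EuclideanSpace ℝ (Fin 3) → ℝ≥0∞), t ≠ 0 →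
      (∀ᵐ x, f x ≤ (Metric.ball 0 3).indicator
        (fun x => ENNReal.ofReal (M * ‖Kker ρ γ x t‖)) x) →
      LpE volume (ENNReal.ofReal q) f ≤ ENNReal.ofReal (L * max 1 (|t| ^ (-3 + γ + 3 / q))) := by
  have hq0 : 0 < q := by linarith
  rcases lt_or_gt_of_ne hne with hlt | hgt
  · have h3q : 3 - γ < 3 / q := by rw [lt_div_iff₀ hq0]; exact hlt
    have h3q0 : 0 < 3 / q := by positivity
    have h3q1 : 3 / q < 1 := by rw [div_lt_one hq0]; exact hq
    obtain ⟨a, ha1, ha2⟩ := exists_between (max_lt h3q h3q0)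
    have ha0 : 0 < a := lt_of_le_of_lt (le_max_right _ _) ha1
    have haγ : 3 - γ ≤ a := (lt_of_le_of_lt (le_max_left _ _) ha1).le
    have haq : a * q < 3 := by rwa [lt_div_iff₀ hq0] at ha2
    obtain ⟨C, hC, hK⟩ := Kker_bound γ hγ ρ hρ hρsupp hρ1 a ha0 (by linarith) haγ
    have hfin := LpE_local_finite a q (M * C) hq0 (mul_nonneg hM hC) haq
    refine ⟨_, ENNReal.toReal_nonneg (a := LpE volume (ENNReal.ofReal q)
      ((Metric.ball (0 : EuclideanSpace ℝ (Fin 3)) 3).indicator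
        (fun x => ENNReal.ofReal (M * C * ‖x‖ ^ (-a))))), ?_⟩
    intro t f ht hf
    refine le_trans (LpE_mono_ae volume q hq0 f ((Metric.ball 0 3).indicator
        (fun x => ENNReal.ofReal (M * C * ‖x‖ ^ (-a)))) ?_) ?_
    · filter_upwards [hf, ae_ne_zero_E3] with x hx hx0
      refine hx.trans (Set.indicator_le_indicator (ENNReal.ofReal_le_ofReal ?_))
      rw [mul_assoc]
      refine mul_le_mul_of_nonneg_left ((hK x t hx0 ht).trans ?_) hM
      refine mul_le_mul_of_nonneg_left ?_ hC
      exact Real.rpow_le_rpow_of_nonpos (norm_pos_iff.mpr hx0)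
        (by linarith [abs_nonneg t]) (by linarith)
    · conv_lhs => rw [← ENNReal.ofReal_toReal hfin.ne]
      refine ENNReal.ofReal_le_ofReal ?_
      exact le_mul_of_one_le_right ENNReal.toReal_nonneg (le_max_left _ _)
  · have ha0 : 0 < 3 - γ := by
      by_contra h
      push Not at h
      nlinarith
    obtain ⟨C, hC, hK⟩ := Kker_bound γ hγ ρ hρ hρsupp hρ1 (3 - γ) ha0 (by linarith) le_rfl
    obtain ⟨A, hA, hS⟩ := LpE_scale (3 - γ) q hq0 hgt
    refine ⟨A * (M * C), by positivity, ?_⟩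
    intro t f ht hf
    refine (hS (M * C) |t| f (mul_nonneg hM hC) (abs_pos.mpr ht) ?_).trans ?_
    · filter_upwards [hf, ae_ne_zero_E3] with x hx hx0
      refine hx.trans ((Set.indicator_le_self' (fun _ _ => zero_le) x).trans
        (ENNReal.ofReal_le_ofReal ?_))
      rw [mul_assoc]
      exact mul_le_mul_of_nonneg_left (hK x t hx0 ht) hM
    · refine ENNReal.ofReal_le_ofReal (mul_le_mul_of_nonneg_left ?_ (by positivity))
      rw [show 3 / q - (3 - γ) = -3 + γ + 3 / q by ring]
      exact le_max_right _ _

/-- Pointwise bound of a windowed function. -/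
lemma window_le (ψ : EuclideanSpace ℝ (Fin 3) → ℝ) (M : ℝ) (hMψ : ∀ x, ‖ψ x‖ ≤ M)
    (hψsupp : Function.support ψ ⊆ Metric.ball 0 1) (z : ℂ)
    (x y : EuclideanSpace ℝ (Fin 3)) :
    (‖z‖₊ : ℝ≥0∞) * ‖ψ (x - y)‖₊ ≤
      (Metric.ball y 1).indicator (fun _ => ENNReal.ofReal (M * ‖z‖)) x := by
  by_cases hx : x ∈ Metric.ball y 1
  · rw [Set.indicator_of_mem hx, ← enorm_eq_nnnorm, ← enorm_eq_nnnorm, ← ofReal_norm,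
      ← ofReal_norm, ← ENNReal.ofReal_mul (norm_nonneg _), mul_comm]
    exact ENNReal.ofReal_le_ofReal (mul_le_mul_of_nonneg_right (hMψ _) (norm_nonneg _))
  · have : ψ (x - y) = 0 := by
      by_contra h
      have := hψsupp (show x - y ∈ Function.support ψ from h)
      apply hx
      rw [Metric.mem_ball, dist_eq_norm]
      simpa using this
    simp [this]

theorem Kker_time_decay (γ r r' : ℝ) (hγ : 2 < γ) (hr6 : 6 < r) (hrr : r ≤ r')
    (hr'ne : r' ≠ 6 / (3 - γ)) (ρ : ℝ → ℝ)
    (hρ : ContDiff ℝ (⊤ : ℕ∞) ρ) (hρsupp : Function.support ρ ⊆ Set.Ioo (-2) 2)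
    (hρ1 : ∀ s : ℝ, |s| ≤ 1 → ρ s = 1)
    (ψ : EuclideanSpace ℝ (Fin 3) → ℝ) (hψ : ContDiff ℝ (⊤ : ℕ∞) ψ)
    (hψsupp : Function.support ψ ⊆ Metric.ball 0 1) (hψne : ψ ≠ 0) :
    ∃ C : ℝ, 0 < C ∧ ∀ t : ℝ, t ≠ 0 →
      (1 ≤ |t| →
        WAx ψ (ENNReal.ofReal (r' / 2)) (ENNReal.ofReal (r / 2))
            (fun x => (‖Kker ρ γ x t‖₊ : ℝ≥0∞))
          ≤ ENNReal.ofReal (C * |t| ^ (-1 + 6 / r))) ∧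
      (|t| ≤ 1 →
        WAx ψ (ENNReal.ofReal (r' / 2)) (ENNReal.ofReal (r / 2))
            (fun x => (‖Kker ρ γ x t‖₊ : ℝ≥0∞))
          ≤ ENNReal.ofReal (C * max 1 (|t| ^ (-3 + γ + 6 / r')))) := by
  have hcs : HasCompactSupport ψ :=
    HasCompactSupport.of_support_subset_isCompact (isCompact_closedBall 0 1)
      (hψsupp.trans Metric.ball_subset_closedBall)
  obtain ⟨M, hMψ⟩ := hcs.exists_bound_of_continuous hψ.continuous
  have hM : 0 ≤ M := (norm_nonneg _).trans (hMψ 0)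
  have hr0 : 0 < r := by linarith
  have hr'0 : 0 < r' := by linarith
  have hq : 3 < r' / 2 := by linarith
  have hne : (3 - γ) * (r' / 2) ≠ 3 := by
    intro h
    have h0 : 3 - γ ≠ 0 := by
      intro h0
      rw [h0] at h
      norm_num at h
    apply hr'ne
    rw [eq_div_iff h0]
    linarith
  obtain ⟨L, hL, hloc⟩ := Kker_local γ (r' / 2) M hγ hq hne hM ρ hρ hρsupp hρ1
  obtain ⟨C, hC, hK⟩ := Kker_bound γ hγ ρ hρ hρsupp hρ1 1 one_pos le_rfl (by linarith)
  obtain ⟨B, hB, hball⟩ := LpE_unit_ball (r' / 2) (by linarith)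
  obtain ⟨A, hA, hS⟩ := LpE_scale 1 (r / 2) (by linarith) (by linarith)
  refine ⟨A * (B * (M * (C * 2))) + A * (3 * (L + B * (M * C))) + 1, by positivity, ?_⟩
  intro t ht
  have ht0 : 0 < |t| := abs_pos.mpr ht
  have hK' : ∀ x : EuclideanSpace ℝ (Fin 3), x ≠ 0 → ‖Kker ρ γ x t‖ ≤ C * (‖x‖ + |t|)⁻¹ := by
    intro x hx
    simpa [Real.rpow_neg_one] using hK x t hx ht
  -- inner norm bound from a uniform bound of the kernel on the unit ball
  have hinner : ∀ (y : EuclideanSpace ℝ (Fin 3)) (E : ℝ), 0 ≤ E →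
      (∀ x, x ≠ 0 → ‖x - y‖ < 1 → ‖Kker ρ γ x t‖ ≤ E) →
      LpE volume (ENNReal.ofReal (r' / 2))
        (fun x => (‖Kker ρ γ x t‖₊ : ℝ≥0∞) * ‖ψ (x - y)‖₊) ≤ ENNReal.ofReal (B * (M * E)) := by
    intro y E hE h
    refine hball (M * E) y _ (mul_nonneg hM hE) ?_
    filter_upwards [ae_ne_zero_E3] with x hx
    refine (window_le ψ M hMψ hψsupp _ x y).trans ?_
    by_cases hxy : x ∈ Metric.ball y 1
    · rw [Set.indicator_of_mem hxy, Set.indicator_of_mem hxy]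
      refine ENNReal.ofReal_le_ofReal (mul_le_mul_of_nonneg_left (h x hx ?_) hM)
      rwa [Metric.mem_ball, dist_eq_norm] at hxy
    · rw [Set.indicator_of_notMem hxy, Set.indicator_of_notMem hxy]
  have hyx : ∀ x y : EuclideanSpace ℝ (Fin 3), ‖x - y‖ < 1 → ‖y‖ ≤ ‖x‖ + 1 := by
    intro x y h
    have := norm_sub_norm_le y x
    rw [norm_sub_rev] at this
    linarith
  constructor
  · intro ht1
    unfold WAx
    refine (hS (B * (M * (C * 2))) |t| _ (by positivity) ht0
      (Filter.Eventually.of_forall fun y => ?_)).trans ?_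
    · refine (hinner y (C * 2 * (‖y‖ + |t|)⁻¹) (by positivity) ?_).trans
        (ENNReal.ofReal_le_ofReal ?_)
      · intro x hx hxy
        refine (hK' x hx).trans ?_
        rw [mul_assoc]
        refine mul_le_mul_of_nonneg_left ?_ hC
        rw [← div_eq_mul_inv, le_div_iff₀ (by positivity), inv_mul_le_iff₀ (by positivity)]
        have := hyx x y hxy
        have := norm_nonneg x
        linarith
      · rw [Real.rpow_neg_one]
        apply le_of_eq
        ring
    · refine ENNReal.ofReal_le_ofReal ?_
      rw [show 3 / (r / 2) - 1 = -1 + 6 / r by field_simp; ring]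
      refine mul_le_mul_of_nonneg_right ?_ (by positivity)
      have : 0 ≤ A * (3 * (L + B * (M * C))) := by positivity
      linarith
  · intro ht1
    unfold WAx
    have hexp : -3 + γ + 3 / (r' / 2) = -3 + γ + 6 / r' := by field_simp; ring
    set m := max 1 (|t| ^ (-3 + γ + 6 / r')) with hm
    have hm1 : 1 ≤ m := le_max_left _ _
    have hm0 : 0 ≤ m := by linarith
    refine (hS (3 * (L + B * (M * C)) * m) 1 _ (by positivity) one_pos
      (Filter.Eventually.of_forall fun y => ?_)).trans ?_
    · rw [Real.rpow_neg_one]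
      have hy0 := norm_nonneg y
      by_cases hy : ‖y‖ < 2
      · refine (hloc t _ ht (Filter.Eventually.of_forall fun x => ?_)).trans
          (ENNReal.ofReal_le_ofReal ?_)
        · refine (window_le ψ M hMψ hψsupp _ x y).trans ?_
          by_cases hxy : x ∈ Metric.ball y 1
          · have hx3 : x ∈ Metric.ball (0 : EuclideanSpace ℝ (Fin 3)) 3 := by
              refine Metric.ball_subset_ball' ?_ hxy
              rw [dist_zero_right]
              linarith
            rw [Set.indicator_of_mem hxy, Set.indicator_of_mem hx3]
          · rw [Set.indicator_of_notMem hxy]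
            exact zero_le
        · rw [hexp, ← hm, ← div_eq_mul_inv, le_div_iff₀ (by positivity)]
          have h1 : L * m * (‖y‖ + 1) ≤ L * m * 3 :=
            mul_le_mul_of_nonneg_left (by linarith) (by positivity)
          have h2 : 0 ≤ B * (M * C) * m := by positivity
          linarith
      · push Not at hy
        refine (hinner y (C * 3 * (‖y‖ + 1)⁻¹) (by positivity) ?_).trans
          (ENNReal.ofReal_le_ofReal ?_)
        · intro x hx hxy
          refine (hK' x hx).trans ?_
          rw [mul_assoc]
          refine mul_le_mul_of_nonneg_left ?_ hC
          rw [← div_eq_mul_inv, le_div_iff₀ (by positivity), inv_mul_le_iff₀ (by positivity)]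
          have := hyx x y hxy
          linarith
        · rw [show B * (M * (C * 3 * (‖y‖ + 1)⁻¹)) = 3 * (B * (M * C)) * (‖y‖ + 1)⁻¹ by ring]
          refine mul_le_mul_of_nonneg_right ?_ (by positivity)
          have h1 : B * (M * C) ≤ B * (M * C) * m := le_mul_of_one_le_right (by positivity) hm1
          have h2 : 0 ≤ L * m := by positivity
          linarith
    · refine ENNReal.ofReal_le_ofReal ?_
      rw [Real.one_rpow, mul_one, ← mul_assoc]
      refine mul_le_mul_of_nonneg_right ?_ hm0
      have : 0 ≤ A * (B * (M * (C * 2))) := by positivity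
      linarith

end
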